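/- arXiv:2304.07161 — 2 statements merged into one kernel-verified Lean document; each statement's English description precedes it below -/
import Mathlib

section
/- Let n be a positive natural number, let F̃ ⊆ ℝⁿ be a nonempty compact set, let f : ℝⁿ → ℝ and C : ℝⁿ → ℝ be continuous, assume C(x) ≥ 0 for all x ∈ F̃, and assume the feasible set F = {x ∈ F̃ : C(x) ≤ 0} is nonempty. Then strong duality holds for the penalized problem: min_{x ∈ F} f(x) = sup_{λ ≥ 0} ( min_{x ∈ F̃} ( f(x) + λ·C(x) ) ). (Both inner minima exist by compactness and continuity.) -/
open Filter

/-- Strong duality for the penalized problem (Proposition 1/2 of the paper):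
for a nonempty compact set `F̃ ⊆ ℝⁿ`, continuous `f, C` with `C ≥ 0` on `F̃` and
nonempty feasible set `F = {x ∈ F̃ | C x ≤ 0}`,
`min_{x ∈ F} f x = sup_{λ ≥ 0} min_{x ∈ F̃} (f x + λ · C x)`. -/
theorem strong_duality_penalized
    (n : ℕ) (hn : 0 < n) (Ftil : Set (Fin n → ℝ))
    (hFtil_ne : Ftil.Nonempty) (hFtil_cpt : IsCompact Ftil)
    (f C : (Fin n → ℝ) → ℝ) (hf : Continuous f) (hC : Continuous C)
    (hCnonneg : ∀ x ∈ Ftil, 0 ≤ C x)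
    (hfeas : {x ∈ Ftil | C x ≤ 0}.Nonempty) :
    sInf (f '' {x ∈ Ftil | C x ≤ 0}) =
      sSup {v : ℝ | ∃ lam : ℝ, 0 ≤ lam ∧
        v = sInf ((fun x => f x + lam * C x) '' Ftil)} := by
  obtain ⟨m, hm, hmin⟩ := hFtil_cpt.exists_isMinOn hFtil_ne hf.continuousOn
  have hFc : IsCompact {x ∈ Ftil | C x ≤ 0} :=
    hFtil_cpt.inter_right (isClosed_le hC continuous_const)
  obtain ⟨x0, hx0, hx0min⟩ := hFc.exists_isMinOn hfeas hf.continuousOn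
  have hp : sInf (f '' {x ∈ Ftil | C x ≤ 0}) = f x0 := by
    apply IsLeast.csInf_eq
    refine ⟨⟨x0, hx0, rfl⟩, ?_⟩
    rintro _ ⟨x, hx, rfl⟩
    exact hx0min hx
  rw [hp]
  symm
  refine IsLUB.csSup_eq ?_ ⟨_, 0, le_rfl, rfl⟩
  constructor
  · rintro v ⟨lam, hlam, rfl⟩
    have hb : BddBelow ((fun x => f x + lam * C x) '' Ftil) :=
      hFtil_cpt.bddBelow_image (by fun_prop)
    have h1 : sInf ((fun x => f x + lam * C x) '' Ftil) ≤ f x0 + lam * C x0 :=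
      csInf_le hb ⟨x0, hx0.1, rfl⟩
    have h2 : lam * C x0 ≤ 0 := mul_nonpos_of_nonneg_of_nonpos hlam hx0.2
    linarith
  · intro u hu
    apply le_of_forall_pos_le_add
    intro ε hε
    have key : ∃ lam : ℝ, 0 ≤ lam ∧ ∀ x ∈ Ftil, f x0 - ε ≤ f x + lam * C x := by
      have hKc : IsCompact {x ∈ Ftil | f x ≤ f x0 - ε} :=
        hFtil_cpt.inter_right (isClosed_le hf continuous_const)
      rcases Set.eq_empty_or_nonempty {x ∈ Ftil | f x ≤ f x0 - ε} with hK | hK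
      · refine ⟨0, le_rfl, fun x hx => ?_⟩
        by_contra hcon
        have : x ∈ {x ∈ Ftil | f x ≤ f x0 - ε} := ⟨hx, by linarith⟩
        rw [hK] at this
        exact this
      · obtain ⟨k, hk, hkmin⟩ := hKc.exists_isMinOn hK hC.continuousOn
        have hkpos : 0 < C k := by
          by_contra hcon
          have h1 : f x0 ≤ f k := hx0min ⟨hk.1, not_lt.mp hcon⟩
          have h2 := hk.2
          linarith
        have hmx : f m ≤ f x0 := hmin hx0.1
        have hl : 0 ≤ (f x0 - f m) / C k := div_nonneg (by linarith) hkpos.le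
        refine ⟨(f x0 - f m) / C k, hl, fun x hx => ?_⟩
        by_cases hxK : f x ≤ f x0 - ε
        · have h1 : C k ≤ C x := hkmin ⟨hx, hxK⟩
          have h2 : f m ≤ f x := hmin hx
          have h3 := mul_le_mul_of_nonneg_left h1 hl
          rw [div_mul_cancel₀ _ hkpos.ne'] at h3
          linarith
        · have := mul_nonneg hl (hCnonneg x hx)
          linarith
    obtain ⟨lam, hlam, hle⟩ := key
    have h1 : f x0 - ε ≤ sInf ((fun x => f x + lam * C x) '' Ftil) := by
      apply le_csInf (hFtil_ne.image _)
      rintro _ ⟨x, hx, rfl⟩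
      exact hle x hx
    have h2 := hu ⟨lam, hlam, rfl⟩
    linarith
end

section
/- For all real numbers x > 0, y > 0, x⁰ > 0, y⁰ > 0, it holds that Real.log(1 + x²/y) ≥ Real.log(1 + (x⁰)²/y⁰) − (x⁰)²/y⁰ + 2·x⁰·x/y⁰ − (x⁰)²·(x² + y) / ( y⁰·((x⁰)² + y⁰) ). -/
/-- Concave lower bound on `(x, y) ↦ log(1 + x²/y)` around a reference point `(x⁰, y⁰)`,
used in the successive convex approximation algorithms of the paper. -/
theorem log_one_add_sq_div_lower_bound
    (x y x0 y0 : ℝ) (hx : 0 < x) (hy : 0 < y) (hx0 : 0 < x0) (hy0 : 0 < y0) :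
    Real.log (1 + x ^ 2 / y) ≥
      Real.log (1 + x0 ^ 2 / y0) - x0 ^ 2 / y0 + 2 * x0 * x / y0 -
        x0 ^ 2 * (x ^ 2 + y) / (y0 * (x0 ^ 2 + y0)) := by
  have hA : 0 < 1 + x ^ 2 / y := by positivity
  have hB : 0 < 1 + x0 ^ 2 / y0 := by positivity
  have h1 := Real.log_le_sub_one_of_pos (div_pos hB hA)
  rw [Real.log_div hB.ne' hA.ne'] at h1
  have h2 : 1 - (1 + x0 ^ 2 / y0) / (1 + x ^ 2 / y) -
      (- (x0 ^ 2 / y0) + 2 * x0 * x / y0 - x0 ^ 2 * (x ^ 2 + y) / (y0 * (x0 ^ 2 + y0))) =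
      ((x0 ^ 2 + y0) * x - x0 * (x ^ 2 + y)) ^ 2 /
        (y0 * (x ^ 2 + y) * (x0 ^ 2 + y0)) := by
    have e1 : x ^ 2 + y ≠ 0 := by positivity
    have e2 : x0 ^ 2 + y0 ≠ 0 := by positivity
    have e3 : (1 + x0 ^ 2 / y0) / (1 + x ^ 2 / y) =
        (x0 ^ 2 + y0) * y / (y0 * (x ^ 2 + y)) := by
      rw [div_eq_div_iff hA.ne' (by positivity)]
      field_simp
      ring
    rw [e3]
    field_simp
    ring
  have h3 : 0 ≤ ((x0 ^ 2 + y0) * x - x0 * (x ^ 2 + y)) ^ 2 /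
        (y0 * (x ^ 2 + y) * (x0 ^ 2 + y0)) := by positivity
  linarith
end
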